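/- Let n≥4, 1≤i<j≤n−2, and let k∈ℕ^n be the vector with k_ℓ=1 for i≤ℓ≤j−1, k_ℓ=2 for j≤ℓ≤n−2, k_{n−1}=k_n=1, and k_ℓ=0 otherwise (the coefficient vector of the root [i,n,j]). For any F∈S_k with numerator f, the Laurent polynomial in w,w′ obtained from f by the substitution x_{ℓ,1}↦v^{1−ℓ}w for i≤ℓ≤n−1, x_{n,1}↦v^{2−n}w, and x_{ℓ,2}↦v^{ℓ+3−2n}w′ for j≤ℓ≤n−2, is divisible in ℚ(v)[w^{±1},w′^{±1}] by ∏_{ℓ=j}^{n−2}(w−v^{2ℓ+4−2n}w′)(w−v^{2ℓ−2n}w′). -/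

import Mathlib

noncomputable section
open scoped BigOperators DirectSum

/-! ### Base field ℚ(v) and quantum numbers -/

/-- the base field `ℚ(v)`. -/
abbrev KK : Type := RatFunc ℚ
/-- the variable `v ∈ ℚ(v)`. -/
def vv : KK := RatFunc.X
/-- integer powers of `v`. -/
def vpow (m : ℤ) : KK := vv ^ m
/-- the quantum integer `[m]_u = (uᵐ - u⁻ᵐ)/(u - u⁻¹)`. -/
def qInt (u : KK) (m : ℕ) : KK := (u ^ (m : ℤ) - u ^ (-(m : ℤ))) / (u - u⁻¹)
/-- the quantum factorial `[m]_u!`. -/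
def qFact (u : KK) (m : ℕ) : KK := ∏ k ∈ Finset.range m, qInt u (k + 1)
/-- the quantum binomial coefficient. -/
def qBinom (u : KK) (m k : ℕ) : KK := qFact u m / (qFact u k * qFact u (m - k))
/-- `⟨m⟩_v = vᵐ - v⁻ᵐ`. -/
def qBrack (m : ℕ) : KK := vpow (m : ℤ) - vpow (-(m : ℤ))
/-- the sign `ε ∈ {+,-}` as `±1`. -/
def sgn (ε : Bool) : ℤ := if ε then 1 else -1
/-- `l` is an integer power of `v`. -/
def IsVpow (l : KK) : Prop := ∃ m : ℤ, l = vpow m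

/-! ### Cartan data of types `C_n` and `D_n` (1-based indices) -/

/-- the Cartan matrix of type `C_n` (1-based indices). -/
def aC (n i j : ℕ) : ℤ :=
  if i = j then 2 else if i + 1 = n ∧ j = n then -2
  else if i + 1 = j ∨ j + 1 = i then -1 else 0
/-- the symmetrizing integers `d_i` of type `C_n`. -/
def dC (n i : ℕ) : ℕ := if i = n then 2 else 1
/-- the Cartan matrix of type `D_n` (1-based indices). -/
def aD (n i j : ℕ) : ℤ :=
  if i = j then 2
  else if (i + 1 = j ∧ j + 1 ≤ n) ∨ (j + 1 = i ∧ i + 1 ≤ n) then -1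
  else if (i + 2 = n ∧ j = n) ∨ (j + 2 = n ∧ i = n) then -1 else 0
/-- the symmetrizing integers `d_i` of type `D_n` (all equal to `1`). -/
def dD (n i : ℕ) : ℕ := 1

section Shuffle
variable (n : ℕ) (A : ℕ → ℕ → ℤ) (Dd : ℕ → ℕ)

abbrev Vars (k : Fin n → ℕ) : Type := Σ i : Fin n, Fin (k i)
abbrev Pk (k : Fin n → ℕ) := MvPolynomial (Vars n k) KK
abbrev Fk (k : Fin n → ℕ) := FractionRing (Pk n k)

def xvr {k : Fin n → ℕ} (u : Vars n k) : Fk n k := algebraMap (Pk n k) (Fk n k) (MvPolynomial.X u)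
def cf {k : Fin n → ℕ} (a : KK) : Fk n k := algebraMap KK (Fk n k) a

def emb1f (k l : Fin n → ℕ) : Vars n k → Vars n (k + l) :=
  fun u => ⟨u.1, ⟨u.2.1, by have h := u.2.2; show u.2.1 < k u.1 + l u.1; omega⟩⟩
def emb2f (k l : Fin n → ℕ) : Vars n l → Vars n (k + l) :=
  fun u => ⟨u.1, ⟨k u.1 + u.2.1, by have h := u.2.2; show k u.1 + u.2.1 < k u.1 + l u.1; omega⟩⟩

lemma emb1f_inj (k l : Fin n → ℕ) : Function.Injective (emb1f n k l) := by
  rintro ⟨i, r⟩ ⟨j, s⟩ h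
  simp only [emb1f, Sigma.mk.inj_iff] at h
  obtain ⟨rfl, h2⟩ := h
  rw [heq_iff_eq, Fin.mk.injEq] at h2
  exact congrArg _ (Fin.ext h2)

lemma emb2f_inj (k l : Fin n → ℕ) : Function.Injective (emb2f n k l) := by
  rintro ⟨i, r⟩ ⟨j, s⟩ h
  simp only [emb2f, Sigma.mk.inj_iff] at h
  obtain ⟨rfl, h2⟩ := h
  rw [heq_iff_eq, Fin.mk.injEq] at h2
  exact congrArg _ (Fin.ext (by omega))

def permVf {m : Fin n → ℕ} (σ : ∀ i, Equiv.Perm (Fin (m i))) : Vars n m → Vars n m :=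
  fun u => ⟨u.1, σ u.1 u.2⟩

lemma permVf_inj {m : Fin n → ℕ} (σ : ∀ i, Equiv.Perm (Fin (m i))) :
    Function.Injective (permVf n σ) := by
  rintro ⟨i, r⟩ ⟨j, s⟩ h
  simp only [permVf, Sigma.mk.inj_iff] at h
  obtain ⟨rfl, h2⟩ := h
  rw [heq_iff_eq] at h2
  exact congrArg _ ((σ i).injective h2)

/-- extension of an (injective) renaming of variables to fraction fields. -/
def liftHom {k m : Fin n → ℕ} (f : Vars n k → Vars n m) (hf : Function.Injective f) :
    Fk n k →+* Fk n m :=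
  IsFractionRing.lift (g := (algebraMap (Pk n m) (Fk n m)).comp
      (MvPolynomial.rename f).toRingHom)
    (by
      rw [RingHom.coe_comp]
      exact Function.Injective.comp (IsFractionRing.injective _ _)
        (by simpa using MvPolynomial.rename_injective (R := KK) f hf))

def emb1 (k l : Fin n → ℕ) : Fk n k →+* Fk n (k + l) := liftHom n (emb1f n k l) (emb1f_inj n k l)
def emb2 (k l : Fin n → ℕ) : Fk n l →+* Fk n (k + l) := liftHom n (emb2f n k l) (emb2f_inj n k l)
def permF {m : Fin n → ℕ} (σ : ∀ i, Equiv.Perm (Fin (m i))) : Fk n m →+* Fk n m :=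
  liftHom n (permVf n σ) (permVf_inj n σ)

/-- the product of `ζ`-factors in the shuffle product. -/
def zfac (k l : Fin n → ℕ) : Fk n (k + l) :=
  ∏ i : Fin n, ∏ j : Fin n, ∏ r : Fin (k i), ∏ s : Fin (l j),
    (xvr n (emb1f n k l ⟨i, r⟩) -
        cf n (vpow (-((Dd (i.1 + 1) : ℤ) * A (i.1 + 1) (j.1 + 1)))) * xvr n (emb2f n k l ⟨j, s⟩)) /
      (xvr n (emb1f n k l ⟨i, r⟩) - xvr n (emb2f n k l ⟨j, s⟩))

/-- the shuffle product on homogeneous components. -/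
def shufMul (k l : Fin n → ℕ) (F : Fk n k) (G : Fk n l) : Fk n (k + l) :=
  (((∏ i, Nat.factorial (k i)) * (∏ i, Nat.factorial (l i)) : ℕ) : KK)⁻¹ •
    ∑ σ : ∀ i : Fin n, Equiv.Perm (Fin ((k + l) i)),
      permF n σ (emb1 n k l F * emb2 n k l G * zfac n A Dd k l)

abbrev BigS := ⨁ k : Fin n → ℕ, Fk n k

open Classical in
/-- the shuffle product, extended bilinearly to the direct sum. -/
def bstar (x y : BigS n) : BigS n :=
  DFinsupp.sum x fun k xk => DFinsupp.sum y fun l yl =>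
    DirectSum.of (fun k => Fk n k) (k + l) (shufMul n A Dd k l xk yl)

def Dpoly (k : Fin n → ℕ) : Pk n k :=
  ∏ i : Fin n, ∏ j : Fin n,
    if i < j ∧ A (i.1 + 1) (j.1 + 1) ≠ 0 then
      ∏ r : Fin (k i), ∏ s : Fin (k j), (MvPolynomial.X ⟨i, r⟩ - MvPolynomial.X (⟨j, s⟩ : Vars n k))
    else 1

def xProd (k : Fin n → ℕ) : Pk n k := ∏ u : Vars n k, MvPolynomial.X u

/-- `f` is symmetric in the variables of each color. -/
def symmQ {k : Fin n → ℕ} (f : Pk n k) : Prop :=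
  ∀ σ : ∀ i, Equiv.Perm (Fin (k i)), MvPolynomial.rename (permVf n σ) f = f

def wheelSub {k : Fin n → ℕ} (i j : Fin n) (m : ℕ) (hm : 0 < m)
    (s : Fin m → Fin (k i)) (r : Fin (k j)) : Vars n k → Pk n k := fun u =>
  if u = ⟨j, r⟩ then
    MvPolynomial.C (vpow ((Dd (i.1 + 1) : ℤ) * A (i.1 + 1) (j.1 + 1))) *
      MvPolynomial.X ⟨i, s ⟨0, hm⟩⟩
  else if h : ∃ t : Fin m, u = ⟨i, s t⟩ then
    MvPolynomial.C (vpow ((Dd (i.1 + 1) : ℤ) * (-2 * (h.choose.1 : ℤ)))) *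
      MvPolynomial.X ⟨i, s ⟨0, hm⟩⟩
  else MvPolynomial.X u

/-- the wheel conditions. -/
def wheelQ {k : Fin n → ℕ} (f : Pk n k) : Prop :=
  ∀ (i j : Fin n), i ≠ j → ∀ hA : A (i.1 + 1) (j.1 + 1) < 0,
    ∀ s : Fin (1 - A (i.1 + 1) (j.1 + 1)).toNat → Fin (k i), Function.Injective s →
      ∀ r : Fin (k j),
        MvPolynomial.aeval (wheelSub n A Dd i j _ (by omega) s r) f = 0

/-- membership in the component `S_k` of the shuffle algebra: `F = f / (denominator)` with `f`
a symmetric Laurent polynomial satisfying the wheel conditions. -/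
def inS {k : Fin n → ℕ} (F : Fk n k) : Prop :=
  ∃ (f : Pk n k) (m : ℕ), symmQ n f ∧ wheelQ n A Dd f ∧
    F * algebraMap (Pk n k) (Fk n k) (Dpoly n A k * xProd n k ^ m) = algebraMap (Pk n k) (Fk n k) f

end Shuffle

/-- the coefficient vector `k ∈ ℕ^n` of the type-`D_n` root `[i,n,j]` (`i < j ≤ n-2`):
`k_ℓ = 1` for `i ≤ ℓ ≤ j-1`, `k_ℓ = 2` for `j ≤ ℓ ≤ n-2`, `k_{n-1} = k_n = 1`,
`k_ℓ = 0` otherwise (1-based). -/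
def kINJ (n i j : ℕ) : Fin n → ℕ := fun l =>
  if i ≤ l.1 + 1 ∧ l.1 + 1 + 1 ≤ j then 1
  else if j ≤ l.1 + 1 ∧ l.1 + 1 ≤ n - 2 then 2
  else if l.1 + 1 = n - 1 ∨ l.1 + 1 = n then 1 else 0

/-- the substitution `x_{ℓ,1} ↦ v^{1-ℓ}w` (`ℓ ≤ n-1`), `x_{n,1} ↦ v^{2-n}w`,
`x_{ℓ,2} ↦ v^{ℓ+3-2n}w'` (`j ≤ ℓ ≤ n-2`), where `w = X 0` and `w' = X 1`. -/
def subINJ (n i j : ℕ) : Vars n (kINJ n i j) → MvPolynomial (Fin 2) KK := fun u =>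
  if u.2.1 = 0 then
    (if u.1.1 + 1 = n then MvPolynomial.C (vpow (2 - (n : ℤ)))
     else MvPolynomial.C (vpow (1 - (u.1.1 + 1 : ℤ)))) * MvPolynomial.X 0
  else MvPolynomial.C (vpow ((u.1.1 + 1 : ℤ) + 3 - 2 * n)) * MvPolynomial.X 1

section LinearForms
open MvPolynomial

variable {σ K : Type*} [DecidableEq σ] [Field K]

/-- `X i - c X j` divides `F` if and only if `F` vanishes after substituting `X i = c X j`. -/
lemma X_sub_C_mul_X_dvd_iff {i j : σ} (hij : i ≠ j) (c : K) (F : MvPolynomial σ K) :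
    X i - C c * X j ∣ F ↔ aeval (Function.update X i (C c * X j)) F = 0 := by
  constructor
  · rintro ⟨G, rfl⟩
    simp [← algebraMap_eq, Function.update_of_ne hij.symm]
  · intro h
    let I : Ideal (MvPolynomial σ K) := Ideal.span {X i - C c * X j}
    have key : (Ideal.Quotient.mkₐ K I).comp (aeval (Function.update X i (C c * X j))) =
        Ideal.Quotient.mkₐ K I := by
      ext m
      by_cases hm : m = i
      · subst hm
        simp only [AlgHom.comp_apply, aeval_X, Function.update_self, Ideal.Quotient.mkₐ_eq_mk]
        rw [eq_comm, Ideal.Quotient.eq]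
        exact Ideal.mem_span_singleton_self _
      · simp [hm]
    have hF := DFunLike.congr_fun key F
    rw [AlgHom.comp_apply, h, map_zero, Ideal.Quotient.mkₐ_eq_mk, eq_comm,
      Ideal.Quotient.eq_zero_iff_mem] at hF
    exact Ideal.mem_span_singleton.mp hF

lemma prime_X_sub_C_mul_X {i j : σ} (hij : i ≠ j) (c : K) :
    Prime (X i - C c * X j : MvPolynomial σ K) := by
  refine ⟨fun h => ?_, fun h => ?_, fun a b h => ?_⟩
  · simpa [Pi.single_apply, hij.symm] using congrArg (eval (Pi.single i (1 : K))) h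
  · simpa using (X_sub_C_mul_X_dvd_iff hij c 1).mp h.dvd
  · simpa only [X_sub_C_mul_X_dvd_iff hij, map_mul, mul_eq_zero] using h

lemma isRelPrime_X_sub_C_mul_X {i j k : σ} (hij : i ≠ j) (hik : i ≠ k) {c d : K} (hc : c ≠ 0)
    (h : j ≠ k ∨ c ≠ d) :
    IsRelPrime (X i - C c * X j : MvPolynomial σ K) (X i - C d * X k) := by
  rw [(prime_X_sub_C_mul_X hij c).irreducible.isRelPrime_iff_not_dvd,
    X_sub_C_mul_X_dvd_iff hij]
  intro h0
  have h1 := congrArg (eval (Pi.single j (1 : K))) h0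
  rw [map_sub, map_mul, ← algebraMap_eq, AlgHom.commutes, aeval_X, aeval_X, Function.update_self,
    Function.update_of_ne hik.symm, algebraMap_eq] at h1
  by_cases hjk : k = j
  · subst hjk
    simp only [map_sub, map_mul, eval_C, eval_X, Pi.single_eq_same, mul_one, map_zero] at h1
    exact h.elim (fun h => h rfl) fun h => h (sub_eq_zero.mp h1)
  · simp [hjk, hc] at h1

end LinearForms

lemma vpow_add (a b : ℤ) : vpow (a + b) = vpow a * vpow b :=
  zpow_add₀ RatFunc.X_ne_zero a b

lemma vpow_ne_zero (a : ℤ) : vpow a ≠ 0 :=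
  zpow_ne_zero a RatFunc.X_ne_zero

lemma vpow_injective : Function.Injective vpow := by
  have aux (m : ℕ) (h : vpow m = 1) : m = 0 := by
    have h1 : algebraMap (Polynomial ℚ) (RatFunc ℚ) (Polynomial.X ^ m) =
        algebraMap (Polynomial ℚ) (RatFunc ℚ) 1 := by
      simpa [vpow, vv] using h
    simpa using congrArg Polynomial.natDegree (RatFunc.algebraMap_injective ℚ h1)
  intro a b hab
  have h1 : vpow (a - b) = 1 := by
    rw [vpow, zpow_sub₀ (show vv ≠ 0 from RatFunc.X_ne_zero)]
    exact (div_eq_one_iff_eq (vpow_ne_zero b)).mpr hab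
  have h2 : vpow (b - a) = 1 := by
    rw [vpow, zpow_sub₀ (show vv ≠ 0 from RatFunc.X_ne_zero)]
    exact (div_eq_one_iff_eq (vpow_ne_zero a)).mpr hab.symm
  rcases le_total b a with h | h
  · obtain ⟨m, hm⟩ := Int.le.dest h
    have := aux m (by rwa [show (m : ℤ) = a - b by omega])
    omega
  · obtain ⟨m, hm⟩ := Int.le.dest h
    have := aux m (by rwa [show (m : ℤ) = b - a by omega])
    omega

/-- The wheel condition at an edge `p - q`, for an arbitrary substitution `θ` compatible
with it. -/
lemma aeval_eq_zero_of_wheelQ {n : ℕ} {A : ℕ → ℕ → ℤ} {Dd : ℕ → ℕ} {k : Fin n → ℕ} {f : Pk n k}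
    (hf : wheelQ n A Dd f) {p q : Fin n} (hpq : p ≠ q) (hA : A (p.1 + 1) (q.1 + 1) = -1)
    (hD : Dd (p.1 + 1) = 1) {s₀ s₁ : Fin (k p)} (hs : s₀ ≠ s₁) (r : Fin (k q))
    {R : Type*} [CommRing R] [Algebra KK R] (θ : Vars n k → R)
    (hr : θ ⟨q, r⟩ = algebraMap KK R (vpow (-1)) * θ ⟨p, s₀⟩)
    (hs₁ : θ ⟨p, s₁⟩ = algebraMap KK R (vpow (-2)) * θ ⟨p, s₀⟩) :
    MvPolynomial.aeval θ f = 0 := by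
  have hlt (t : Fin (1 - A (p.1 + 1) (q.1 + 1)).toNat) : t.1 < 2 := by
    have := t.2
    omega
  let s : Fin (1 - A (p.1 + 1) (q.1 + 1)).toNat → Fin (k p) := fun t => if t.1 = 0 then s₀ else s₁
  have hinj : Function.Injective s := by
    intro a b hab
    have ha := hlt a
    have hb := hlt b
    ext
    by_cases h1 : a.1 = 0 <;> by_cases h2 : b.1 = 0 <;> simp only [s, h1, h2, if_true, if_false] at hab
    · omega
    · exact absurd hab hs
    · exact absurd hab.symm hs
    · omega
  have hw := congrArg (MvPolynomial.aeval θ) (hf p q hpq (by omega) s hinj r)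
  rw [map_zero, ← AlgHom.comp_apply, MvPolynomial.comp_aeval] at hw
  convert hw using 3
  ext u
  unfold wheelSub
  split_ifs with h1 h2
  · subst h1
    rw [map_mul, ← MvPolynomial.algebraMap_eq, AlgHom.commutes, MvPolynomial.aeval_X, hr, hD,
      show ((1 : ℕ) : ℤ) * A (p.1 + 1) (q.1 + 1) = -1 by omega]
    rfl
  · have hu := h2.choose_spec
    have ht := hlt h2.choose
    rw [map_mul, ← MvPolynomial.algebraMap_eq, AlgHom.commutes, MvPolynomial.aeval_X, hD]
    generalize h2.choose = t at hu ht
    subst hu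
    rcases (by omega : t.1 = 0 ∨ t.1 = 1) with h | h
    · simp [s, h, vpow]
    · simp only [s, h, if_true, if_false, one_ne_zero, hs₁]
      norm_num
  · simp

/-- The substitution `subINJ` with an independent variable `X ℓ` in place of `w'` for each
colour `ℓ`; the variable `w` is `X 0`. -/
def genINJ (n i j : ℕ) : Vars n (kINJ n i j) → MvPolynomial ℕ KK := fun u =>
  if u.2.1 = 0 then
    (if u.1.1 + 1 = n then MvPolynomial.C (vpow (2 - (n : ℤ)))
     else MvPolynomial.C (vpow (1 - (u.1.1 + 1 : ℤ)))) * MvPolynomial.X 0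
  else MvPolynomial.C (vpow ((u.1.1 + 1 : ℤ) + 3 - 2 * n)) * MvPolynomial.X (u.1.1 + 1)

open MvPolynomial in
lemma aeval_subINJ (n i j : ℕ) (f : Pk n (kINJ n i j)) :
    aeval (subINJ n i j) f =
      aeval (fun m : ℕ => if m = 0 then X 0 else (X 1 : MvPolynomial (Fin 2) KK))
        (aeval (genINJ n i j) f) := by
  rw [← AlgHom.comp_apply, comp_aeval]
  congr 2
  ext1 u
  unfold subINJ genINJ
  split_ifs <;> simp [← algebraMap_eq]

section Divisibility
open MvPolynomial

variable {n i j l : ℕ} {f : Pk n (kINJ n i j)}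

lemma dvd_aeval_genINJ_right (hn : 4 ≤ n) (hij : 1 ≤ i ∧ i < j ∧ j ≤ n - 2)
    (hf : wheelQ n (aD n) (dD n) f) (hjl : j ≤ l) (hln : l ≤ n - 2) :
    (X 0 - C (vpow ((2 * l + 4 : ℤ) - 2 * n)) * X l) ∣ aeval (genINJ n i j) f := by
  obtain ⟨m, rfl⟩ : ∃ m, l = m + 1 := ⟨l - 1, by omega⟩
  rw [X_sub_C_mul_X_dvd_iff (by omega), ← AlgHom.comp_apply, comp_aeval]
  have hk : kINJ n i j ⟨m, by omega⟩ = 2 := by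
    simp only [kINJ]
    split_ifs <;> omega
  have hk' : 0 < kINJ n i j ⟨m + 1, by omega⟩ := by
    simp only [kINJ]
    split_ifs <;> omega
  refine aeval_eq_zero_of_wheelQ hf (p := ⟨m, by omega⟩) (q := ⟨m + 1, by omega⟩) (by simp)
    ((if_neg (by simp)).trans (if_pos (Or.inl ⟨rfl, by dsimp only; omega⟩))) rfl (s₀ := ⟨0, by omega⟩) (s₁ := ⟨1, by omega⟩)
    (by simp) ⟨0, hk'⟩ _ ?_ ?_
  · simp only [genINJ, if_true, if_neg (show ¬ m + 1 = n by omega),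
      if_neg (show ¬ m + 1 + 1 = n by omega), map_mul, ← algebraMap_eq, AlgHom.commutes, aeval_X,
      Function.update_self, ← mul_assoc]
    simp only [← map_mul, ← vpow_add]
    congr 4
    push_cast
    ring
  · simp only [genINJ, if_true, if_neg (show ¬ m + 1 = n by omega), one_ne_zero, if_false,
      map_mul, ← algebraMap_eq, AlgHom.commutes, aeval_X,
      Function.update_self, Function.update_of_ne (show m + 1 ≠ 0 by omega), ← mul_assoc]
    simp only [← map_mul, ← vpow_add]
    congr 3
    push_cast
    ring

lemma dvd_aeval_genINJ_left (hn : 4 ≤ n) (hij : 1 ≤ i ∧ i < j ∧ j ≤ n - 2)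
    (hf : wheelQ n (aD n) (dD n) f) (hjl : j ≤ l) (hln : l ≤ n - 2) :
    (X 0 - C (vpow ((2 * l : ℤ) - 2 * n)) * X l) ∣ aeval (genINJ n i j) f := by
  obtain ⟨m, rfl⟩ : ∃ m, l = m + 1 + 1 := ⟨l - 2, by omega⟩
  rw [X_sub_C_mul_X_dvd_iff (by omega), ← AlgHom.comp_apply, comp_aeval]
  have hk : kINJ n i j ⟨m + 1, by omega⟩ = 2 := by
    simp only [kINJ]
    split_ifs <;> omega
  have hk' : 0 < kINJ n i j ⟨m, by omega⟩ := by
    simp only [kINJ]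
    split_ifs <;> omega
  refine aeval_eq_zero_of_wheelQ hf (p := ⟨m + 1, by omega⟩) (q := ⟨m, by omega⟩) (by simp)
    ((if_neg (by simp)).trans (if_pos (Or.inr ⟨rfl, by dsimp only; omega⟩))) rfl (s₀ := ⟨1, by omega⟩) (s₁ := ⟨0, by omega⟩)
    (by simp) ⟨0, hk'⟩ _ ?_ ?_
  · simp only [genINJ, if_true, if_neg (show ¬ m + 1 = n by omega), one_ne_zero, if_false,
      map_mul, ← algebraMap_eq, AlgHom.commutes, aeval_X,
      Function.update_self, Function.update_of_ne (show m + 1 + 1 ≠ 0 by omega), ← mul_assoc]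
    simp only [← map_mul, ← vpow_add]
    congr 3
    push_cast
    ring
  · simp only [genINJ, if_true, if_neg (show ¬ m + 1 + 1 = n by omega), one_ne_zero, if_false,
      map_mul, ← algebraMap_eq, AlgHom.commutes, aeval_X,
      Function.update_self, Function.update_of_ne (show m + 1 + 1 ≠ 0 by omega), ← mul_assoc]
    simp only [← map_mul, ← vpow_add]
    congr 3
    push_cast
    ring

lemma prod_dvd_aeval_genINJ (hn : 4 ≤ n) (hij : 1 ≤ i ∧ i < j ∧ j ≤ n - 2)
    (hf : wheelQ n (aD n) (dD n) f) :
    (∏ l ∈ Finset.Icc j (n - 2), ((X 0 - C (vpow ((2 * l + 4 : ℤ) - 2 * n)) * X l) *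
      (X 0 - C (vpow ((2 * l : ℤ) - 2 * n)) * X l))) ∣ aeval (genINJ n i j) f := by
  apply Finset.prod_dvd_of_isRelPrime
  · intro a ha b hb hab
    simp only [Finset.coe_Icc, Set.mem_Icc] at ha hb
    have rel (c d : ℤ) : IsRelPrime (X 0 - C (vpow c) * X a : MvPolynomial ℕ KK)
        (X 0 - C (vpow d) * X b) :=
      isRelPrime_X_sub_C_mul_X (by omega) (by omega) (vpow_ne_zero c) (Or.inl hab)
    exact ((rel _ _).mul_right (rel _ _)).mul_left ((rel _ _).mul_right (rel _ _))
  · intro l hl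
    rw [Finset.mem_Icc] at hl
    refine IsRelPrime.mul_dvd ?_ (dvd_aeval_genINJ_right hn hij hf hl.1 hl.2)
      (dvd_aeval_genINJ_left hn hij hf hl.1 hl.2)
    refine isRelPrime_X_sub_C_mul_X (by omega) (by omega) (vpow_ne_zero _) (Or.inr fun h => ?_)
    have := vpow_injective h
    omega

end Divisibility

/-- **Divisibility from the wheel conditions (type `D_n`)**: let `1 ≤ i < j ≤ n-2` and let
`k` be the coefficient vector of `[i,n,j]`.  For any `F ∈ S_k` with numerator `f`, the image
of `f` under the substitution `x_{ℓ,1} ↦ v^{1-ℓ}w`, `x_{n,1} ↦ v^{2-n}w`,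
`x_{ℓ,2} ↦ v^{ℓ+3-2n}w'` is divisible in `ℚ(v)[w^{±1},w'^{±1}]` by
`∏_{ℓ=j}^{n-2} (w - v^{2ℓ+4-2n}w')(w - v^{2ℓ-2n}w')`. -/
theorem wheel_divisibility_typeD (n : ℕ) (hn : 4 ≤ n) (i j : ℕ)
    (hij : 1 ≤ i ∧ i < j ∧ j ≤ n - 2)
    (f : Pk n (kINJ n i j)) (hsym : symmQ n f) (hwheel : wheelQ n (aD n) (dD n) f) :
    ∃ (g : MvPolynomial (Fin 2) KK) (a b : ℕ),
      MvPolynomial.X 0 ^ a * MvPolynomial.X 1 ^ b * MvPolynomial.aeval (subINJ n i j) f =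
        (∏ l ∈ Finset.Icc j (n - 2),
          ((MvPolynomial.X 0 - MvPolynomial.C (vpow ((2 * l + 4 : ℤ) - 2 * n)) * MvPolynomial.X 1) *
            (MvPolynomial.X 0 - MvPolynomial.C (vpow ((2 * l : ℤ) - 2 * n)) * MvPolynomial.X 1))) * g := by
  obtain ⟨g, hg⟩ := prod_dvd_aeval_genINJ hn hij hwheel
  refine ⟨MvPolynomial.aeval (fun m : ℕ => if m = 0 then MvPolynomial.X 0 else MvPolynomial.X 1) g,
    0, 0, ?_⟩
  rw [aeval_subINJ, hg, map_mul, map_prod, pow_zero, pow_zero, one_mul, one_mul]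
  congr 1
  refine Finset.prod_congr rfl fun l hl => ?_
  rw [Finset.mem_Icc] at hl
  simp [← MvPolynomial.algebraMap_eq, show l ≠ 0 by omega]
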